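/- Let n ≥ 4 and d = n+3. For every triple of nonnegative integers (u,v,w) with u+v+w = n+1, u ≤ 2 and w ≤ 2, the couple (Σ_{2,n,2},(u,v,w)) is realizable; that is, there exists a hyperbolic polynomial of degree d realizing it. -/

import Mathlib

open Polynomial Finset

/-- A real polynomial `P` of degree `d` defines the sign pattern `Σ_{m,n,q}`:
reading the coefficients from that of `x^d` down to the constant term, the first
`m` are positive, the next `n` are negative and the last `q` are positive
(in particular all `d+1` coefficients are nonzero), where `m + n + q = d + 1`. -/
def SignPatternMNQ (P : Polynomial ℝ) (d m n q : ℕ) : Prop :=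
  m + n + q = d + 1 ∧ 0 < m ∧ 0 < n ∧ 0 < q ∧
  (∀ k, k ≤ d → (d - k < m ∨ m + n ≤ d - k) → 0 < P.coeff k) ∧
  (∀ k, k ≤ d → (m ≤ d - k ∧ d - k < m + n) → P.coeff k < 0)

/-- The couple `(Σ_{m,n,q}, (u,v,w))` is realizable (in degree `d`): there is a
hyperbolic polynomial `P` of degree `d` defining the sign pattern `Σ_{m,n,q}`,
whose roots are exactly two positive numbers `β < α` together with `d - 2`
negative numbers `-γ i`, all moduli being distinct, such that exactly `u` of
the `γ i` are `< β`, exactly `v` lie in `(β, α)` and exactly `w` are `> α`. -/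
def RealizesCouple (d m n q u v w : ℕ) : Prop :=
  ∃ (P : Polynomial ℝ) (α β : ℝ) (γ : Fin (d - 2) → ℝ),
    P.natDegree = d ∧
    SignPatternMNQ P d m n q ∧
    0 < β ∧ β < α ∧
    StrictMono γ ∧ (∀ i, 0 < γ i) ∧ (∀ i, γ i ≠ β ∧ γ i ≠ α) ∧
    P.roots = (α ::ₘ β ::ₘ Multiset.map (fun i => -γ i) Finset.univ.val) ∧
    (Finset.univ.filter (fun i => γ i < β)).card = u ∧
    (Finset.univ.filter (fun i => β < γ i ∧ γ i < α)).card = v ∧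
    (Finset.univ.filter (fun i => α < γ i)).card = w

lemma coeff_mul_X_add_C_succ (R : ℝ[X]) (c : ℝ) (k : ℕ) :
    (R * (X + C c)).coeff (k + 1) = R.coeff k + R.coeff (k + 1) * c := by
  simp [mul_add]

lemma coeff_mul_X_add_C_zero (R : ℝ[X]) (c : ℝ) :
    (R * (X + C c)).coeff 0 = R.coeff 0 * c := by
  simp [mul_add]

lemma eventually_pos_nhdsGT_zero {f : ℝ → ℝ} (hf : Continuous f) (h : 0 < f 0) :
    ∀ᶠ x in nhdsWithin (0 : ℝ) (Set.Ioi 0), 0 < f x :=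
  (hf.tendsto 0).mono_left nhdsWithin_le_nhds |>.eventually (lt_mem_nhds h)

lemma eventually_neg_nhdsGT_zero {f : ℝ → ℝ} (hf : Continuous f) (h : f 0 < 0) :
    ∀ᶠ x in nhdsWithin (0 : ℝ) (Set.Ioi 0), f x < 0 :=
  (hf.tendsto 0).mono_left nhdsWithin_le_nhds |>.eventually (gt_mem_nhds h)

lemma eventually_lt_nhdsGT_zero {ι : Type*} [Finite ι] {γ : ι → ℝ} (h : ∀ i, 0 < γ i) (c : ℝ) :
    ∀ᶠ x in nhdsWithin (0 : ℝ) (Set.Ioi 0), ∀ i, c * x < γ i := by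
  refine Filter.eventually_all.2 fun i => ?_
  have := eventually_pos_nhdsGT_zero (f := fun x => γ i - c * x) (by fun_prop) (by simpa using h i)
  filter_upwards [this] with x hx
  linarith

/-- Two positive numbers, exactly `j` of which exceed `1`, such that
`(X - 1) (X + a) (X + b)` has sign pattern `(+, +, -, -)`. -/
lemma exists_pair_cubic_signs (j : ℕ) (hj : j ≤ 2) :
    ∃ a b : ℝ, 0 < a ∧ a < b ∧ a ≠ 1 ∧ b ≠ 1 ∧ 1 < a + b ∧ a * b < a + b ∧
      (if 1 < a then 1 else 0) + (if 1 < b then 1 else 0) = j := by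
  interval_cases j
  · exact ⟨7 / 10, 8 / 10, by norm_num⟩
  · exact ⟨7 / 10, 14 / 10, by norm_num⟩
  · exact ⟨14 / 10, 15 / 10, by norm_num⟩

lemma strictMono_finCons {N : ℕ} {γ : Fin N → ℝ} (hγ : StrictMono γ) {x : ℝ}
    (hx : ∀ i, x < γ i) : StrictMono (Fin.cons x γ : Fin (N + 1) → ℝ) := by
  intro i j hij
  induction i using Fin.cases with
  | zero =>
    induction j using Fin.cases with
    | zero => exact absurd hij (lt_irrefl _)
    | succ j => simpa using hx j
  | succ i =>
    induction j using Fin.cases with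
    | zero => exact absurd hij (Fin.not_lt_zero _)
    | succ j => simpa using hγ (Fin.succ_lt_succ_iff.1 hij)

/-- Hyperbolic polynomials with one positive root and sign pattern `(+, +, -, …, -)`, of which
`w` negative roots have modulus larger than the positive root. -/
lemma exists_one_positive_root (w : ℕ) (hw : w ≤ 2) (m : ℕ) :
    ∃ γ : Fin (m + 2) → ℝ, StrictMono γ ∧ (∀ i, 0 < γ i) ∧ (∀ i, γ i ≠ 1) ∧
      (univ.filter (fun i => 1 < γ i)).card = w ∧
      0 < ((X - C 1) * ∏ i, (X + C (γ i))).coeff (m + 3) ∧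
      0 < ((X - C 1) * ∏ i, (X + C (γ i))).coeff (m + 2) ∧
      ∀ k ≤ m + 1, ((X - C 1) * ∏ i, (X + C (γ i))).coeff k < 0 := by
  induction m with
  | zero =>
    obtain ⟨a, b, ha, hab, ha1, hb1, hs, hp, hj⟩ := exists_pair_cubic_signs w hw
    have hb : 0 < b := ha.trans hab
    have e : ((X - C 1) * ∏ i, (X + C ((![a, b] : Fin 2 → ℝ) i)) : ℝ[X])
        = X ^ 3 + C (a + b - 1) * X ^ 2 + C (a * b - a - b) * X + C (-(a * b)) := by
      simp [Fin.prod_univ_two]; ring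
    refine ⟨![a, b], ?_, ?_, ?_, ?_, ?_⟩
    · intro i j hij
      fin_cases i <;> fin_cases j <;> simp_all
    · intro i; fin_cases i <;> simp_all
    · intro i; fin_cases i <;> simp_all
    · rw [← hj]
      exact (card_filter _ _).trans (Fin.sum_univ_two _)
    · rw [e]
      obtain ⟨p, hp'⟩ : ∃ p, p = a + b - 1 := ⟨_, rfl⟩
      obtain ⟨q, hq'⟩ : ∃ q, q = a * b - a - b := ⟨_, rfl⟩
      rw [← hp', ← hq']
      refine ⟨?_, ?_, ?_⟩
      · simp [coeff_X_pow]
      · simp [coeff_X_pow]; linarith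
      · intro k hk
        have h01 : k = 0 ∨ k = 1 := by omega
        rcases h01 with rfl | rfl
        · simp [coeff_X]; positivity
        · simp [coeff_X_pow, coeff_C]; linarith
  | succ m ih =>
    obtain ⟨γ, hmono, hpos, hne, hcard, h3, h2, hneg⟩ := ih
    set R : ℝ[X] := (X - C 1) * ∏ i, (X + C (γ i)) with hR
    have hev : ∀ᶠ x in nhdsWithin (0 : ℝ) (Set.Ioi 0), ∀ k ∈ range (m + 2),
        R.coeff k + R.coeff (k + 1) * x < 0 := by
      refine (Filter.eventually_all_finset _).2 fun k hk => ?_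
      refine eventually_neg_nhdsGT_zero (by fun_prop) ?_
      simpa using hneg k (by simp at hk; omega)
    have hp3 := eventually_pos_nhdsGT_zero
      (f := fun x => R.coeff (m + 3) + R.coeff (m + 4) * x) (by fun_prop) (by simpa using h3)
    have hp2 := eventually_pos_nhdsGT_zero
      (f := fun x => R.coeff (m + 2) + R.coeff (m + 3) * x) (by fun_prop) (by simpa using h2)
    have hlt := eventually_lt_nhdsGT_zero hpos 1
    have hlt1 := eventually_lt_nhdsGT_zero (γ := fun _ : Unit => (1 : ℝ)) (by simp) 1
    obtain ⟨x, hxev, hx3, hx2, hxlt, hx1, hx0⟩ :=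
      (hev.and (hp3.and (hp2.and (hlt.and (hlt1.and self_mem_nhdsWithin))))).exists
    simp only [one_mul] at hxlt hx1
    replace hx1 := hx1 ()
    replace hx0 : 0 < x := hx0
    have e : ((X - C 1) * ∏ i, (X + C ((Fin.cons x γ : Fin (m + 1 + 2) → ℝ) i)) : ℝ[X])
        = R * (X + C x) := by
      rw [Fin.prod_univ_succ, hR]
      simp only [Fin.cons_zero, Fin.cons_succ]
      ring
    refine ⟨Fin.cons x γ, strictMono_finCons hmono hxlt, ?_, ?_, ?_, ?_⟩
    · intro i
      induction i using Fin.cases <;> simp [hx0, hpos]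
    · intro i
      induction i using Fin.cases <;> simp [hx1.ne, hne]
    · rw [← hcard, Fin.card_filter_univ_succ]
      simp [hx1.not_gt]
    · rw [e]
      refine ⟨?_, ?_, ?_⟩
      · rw [coeff_mul_X_add_C_succ]; exact hx3
      · rw [show m + 1 + 2 = (m + 2) + 1 by ring, coeff_mul_X_add_C_succ]; exact hx2
      · intro k hk
        cases k with
        | zero =>
          rw [coeff_mul_X_add_C_zero]
          exact mul_neg_of_neg_of_pos (hneg 0 (by omega)) hx0
        | succ k =>
          rw [coeff_mul_X_add_C_succ]
          exact hxev k (by simp; omega)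

/-- Theorem 2 (1): for `n ≥ 4` and `d = n + 3`, every couple
`(Σ_{2,n,2}, (u,v,w))` with `u + v + w = n + 1`, `u ≤ 2` and `w ≤ 2`
is realizable. -/
theorem stmt3 (n u v w : ℕ) (hn : 4 ≤ n) (huvw : u + v + w = n + 1)
    (hu : u ≤ 2) (hw : w ≤ 2) :
    RealizesCouple (n + 3) 2 n 2 u v w := by
  obtain ⟨m, rfl⟩ : ∃ m, n = m + 3 := ⟨n - 3, by omega⟩
  obtain ⟨γ, hmono, hpos, hne, hcard, h3, h2, hneg⟩ := exists_one_positive_root w hw m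
  obtain ⟨a, b, ha, hab, ha1, hb1, hs, hp, hj⟩ := exists_pair_cubic_signs (2 - u) (by omega)
  have hb : 0 < b := ha.trans hab
  set R : ℝ[X] := (X - C 1) * ∏ i, (X + C (γ i)) with hR
  have hR0 : R.coeff 0 < 0 := hneg 0 (by omega)
  -- the coefficients of the product of `R` with the rescaled cubic factor
  set S : ℝ → ℝ[X] := fun x => R * (X + C (-x)) * (X + C (a * x)) * (X + C (b * x)) with hS
  have hS3 : ∀ k x, (S x).coeff (k + 3) = R.coeff k + (a + b - 1) * x * R.coeff (k + 1)
      - (a + b - a * b) * x ^ 2 * R.coeff (k + 2) - a * b * x ^ 3 * R.coeff (k + 3) := by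
    intro k x
    simp only [hS, coeff_mul_X_add_C_succ]
    ring
  have hS2 : ∀ x, (S x).coeff 2 = x * ((a + b - 1) * R.coeff 0
      - (a + b - a * b) * x * R.coeff 1 - a * b * x ^ 2 * R.coeff 2) := by
    intro x
    simp only [hS, coeff_mul_X_add_C_succ, coeff_mul_X_add_C_zero]
    ring
  have hS1 : ∀ x, (S x).coeff 1 = x ^ 2 * (-(a + b - a * b) * R.coeff 0
      - a * b * x * R.coeff 1) := by
    intro x
    have := coeff_mul_X_add_C_succ (R * (X + C (-x)) * (X + C (a * x))) (b * x) 0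
    have h' := coeff_mul_X_add_C_succ (R * (X + C (-x))) (a * x) 0
    have h'' := coeff_mul_X_add_C_succ R (-x) 0
    simp only [zero_add] at this h' h''
    simp only [hS, this, h', h'', coeff_mul_X_add_C_zero]
    ring
  have hS0 : ∀ x, (S x).coeff 0 = x ^ 3 * (-(a * b) * R.coeff 0) := by
    intro x
    simp only [hS, coeff_mul_X_add_C_zero]
    ring
  have evneg : ∀ᶠ x in nhdsWithin (0 : ℝ) (Set.Ioi 0), ∀ k ∈ range (m + 2),
      (S x).coeff (k + 3) < 0 := by
    refine (Filter.eventually_all_finset _).2 fun k hk => ?_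
    simp only [hS3]
    refine eventually_neg_nhdsGT_zero (by fun_prop) ?_
    simpa using hneg k (by simp at hk; omega)
  have evpos : ∀ k, 0 < R.coeff k → ∀ᶠ x in nhdsWithin (0 : ℝ) (Set.Ioi 0),
      0 < (S x).coeff (k + 3) := by
    intro k hk
    simp only [hS3]
    refine eventually_pos_nhdsGT_zero (by fun_prop) ?_
    simpa using hk
  have ev2 := eventually_neg_nhdsGT_zero (f := fun x => (a + b - 1) * R.coeff 0
      - (a + b - a * b) * x * R.coeff 1 - a * b * x ^ 2 * R.coeff 2) (by fun_prop)
      (by simpa using mul_neg_of_pos_of_neg (sub_pos.2 hs) hR0)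
  have ev1 := eventually_pos_nhdsGT_zero (f := fun x => -(a + b - a * b) * R.coeff 0
      - a * b * x * R.coeff 1) (by fun_prop)
      (by have := mul_neg_of_pos_of_neg (sub_pos.2 hp) hR0
          simp only [mul_zero, zero_mul, sub_zero]; linarith)
  have evb := eventually_lt_nhdsGT_zero hpos b
  have ev1γ := eventually_lt_nhdsGT_zero hpos 1
  have evb1 := eventually_lt_nhdsGT_zero (γ := fun _ : Unit => (1 : ℝ)) (by simp) b
  have ev11 := eventually_lt_nhdsGT_zero (γ := fun _ : Unit => (1 : ℝ)) (by simp) 1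
  obtain ⟨x, hxneg, hx3, hx2, hxc2, hxc1, hxb, hxγ, hxb1, hx1, hx0⟩ :=
    (evneg.and ((evpos _ h3).and ((evpos _ h2).and (ev2.and (ev1.and (evb.and (ev1γ.and
      (evb1.and (ev11.and self_mem_nhdsWithin))))))))).exists
  replace hx0 : 0 < x := hx0
  replace hxb1 := hxb1 ()
  replace hx1 := hx1 ()
  simp only [one_mul] at hxγ hx1
  have habx : a * x < b * x := mul_lt_mul_of_pos_right hab hx0
  have hax0 : 0 < a * x := mul_pos ha hx0
  have hbx0 : 0 < b * x := mul_pos hb hx0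
  have hax : a * x ≠ x := fun h => ha1 (mul_right_cancel₀ hx0.ne' (by linarith))
  have hbx : b * x ≠ x := fun h => hb1 (mul_right_cancel₀ hx0.ne' (by linarith))
  obtain ⟨δ, hδ⟩ : ∃ δ : Fin (m + 2 + 1 + 1) → ℝ,
    δ = Fin.cons (a * x) (Fin.cons (b * x) γ : Fin (m + 2 + 1) → ℝ) := ⟨_, rfl⟩
  have hδmono : StrictMono δ := by
    rw [hδ]
    refine strictMono_finCons (strictMono_finCons hmono hxb) fun i => ?_
    induction i using Fin.cases with
    | zero => simpa using habx
    | succ i => simpa using habx.trans (hxb i)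
  have hδpos : ∀ i, 0 < δ i := by
    simp only [hδ, Fin.forall_fin_succ (n := m + 2 + 1), Fin.forall_fin_succ (n := m + 2),
      Fin.cons_zero, Fin.cons_succ]
    exact ⟨hax0, hbx0, hpos⟩
  have hδne : ∀ i, δ i ≠ x ∧ δ i ≠ 1 := by
    simp only [hδ, Fin.forall_fin_succ (n := m + 2 + 1), Fin.forall_fin_succ (n := m + 2),
      Fin.cons_zero, Fin.cons_succ]
    exact ⟨⟨hax, (habx.trans hxb1).ne⟩, ⟨hbx, hxb1.ne⟩, fun i => ⟨(hxγ i).ne', hne i⟩⟩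
  have hcu : (univ.filter (fun i => δ i < x)).card = u := by
    rw [hδ, Fin.card_filter_univ_succ, Fin.card_filter_univ_succ]
    have ia : (a * x < x) ↔ ¬ 1 < a := by
      rw [mul_lt_iff_lt_one_left hx0, not_lt]
      exact ⟨le_of_lt, fun h => lt_of_le_of_ne h ha1⟩
    have ib : (b * x < x) ↔ ¬ 1 < b := by
      rw [mul_lt_iff_lt_one_left hx0, not_lt]
      exact ⟨le_of_lt, fun h => lt_of_le_of_ne h hb1⟩
    have hz : (univ.filter (fun i => γ i < x)).card = 0 := by
      simp only [card_eq_zero, filter_eq_empty_iff]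
      exact fun i _ => (hxγ i).not_gt
    simp only [Fin.cons_zero, Fin.cons_succ, ia, ib, hz]
    split_ifs at hj ⊢ <;> omega
  have hcw : (univ.filter (fun i => 1 < δ i)).card = w := by
    rw [hδ, Fin.card_filter_univ_succ, Fin.card_filter_univ_succ, ← hcard]
    simp [(habx.trans hxb1).not_gt, hxb1.not_gt]
  have hcv : (univ.filter (fun i => x < δ i ∧ δ i < 1)).card = v := by
    have key : (univ.filter (fun i => δ i < x)).card
        + (univ.filter (fun i => x < δ i ∧ δ i < 1)).card
        + (univ.filter (fun i => 1 < δ i)).card = m + 2 + 1 + 1 := by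
      simp only [card_filter, ← sum_add_distrib]
      rw [sum_congr rfl (g := fun _ => 1), sum_const, card_univ, Fintype.card_fin, smul_eq_mul,
        mul_one]
      intro i _
      rcases lt_or_gt_of_ne (hδne i).1 with h | h
      · simp [h, h.not_gt, (h.trans hx1).not_gt]
      · rcases lt_or_gt_of_ne (hδne i).2 with h' | h' <;> simp [h, h', h.not_gt, h'.not_gt]
    omega
  have hprod : S x = ((((1 : ℝ) ::ₘ x ::ₘ Multiset.map (fun i => -δ i) univ.val)).map
      (fun r => X - C r)).prod := by
    have : (∏ i, (X + C (δ i)) : ℝ[X]) = (X + C (a * x)) * ((X + C (b * x)) *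
        ∏ i, (X + C (γ i))) := by
      rw [hδ, Fin.prod_univ_succ, Fin.prod_univ_succ]
      simp only [Fin.cons_zero, Fin.cons_succ]
    have h' : (Multiset.map (fun i => (X - C (-δ i) : ℝ[X])) univ.val).prod
        = ∏ i, (X + C (δ i)) := by
      simp [Finset.prod]
    rw [Multiset.map_cons, Multiset.map_cons, Multiset.prod_cons, Multiset.prod_cons,
      Multiset.map_map, Function.comp_def, h', this, hS, hR]
    simp only [C_neg]
    ring
  refine ⟨S x, 1, x, δ, ?_, ⟨by omega, by omega, by omega, by omega, ?_, ?_⟩, hx0, hx1, hδmono,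
    hδpos, hδne, ?_, hcu, hcv, hcw⟩
  · rw [hprod, natDegree_multiset_prod_X_sub_C_eq_card]
    simp
  · intro k hk hk'
    have hcases : k = 0 ∨ k = 1 ∨ k = m + 2 + 3 ∨ k = m + 3 + 3 := by omega
    rcases hcases with rfl | rfl | rfl | rfl
    · rw [hS0]
      exact mul_pos (by positivity) (mul_pos_of_neg_of_neg (by simp; positivity) hR0)
    · rw [hS1]
      exact mul_pos (by positivity) hxc1
    · exact hx2
    · exact hx3
  · intro k hk hk'
    rcases Nat.lt_or_ge k 3 with h | h
    · obtain rfl : k = 2 := by omega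
      rw [hS2]
      exact mul_neg_of_pos_of_neg hx0 hxc2
    · obtain ⟨j, rfl⟩ : ∃ j, k = j + 3 := ⟨k - 3, by omega⟩
      exact hxneg j (by simp; omega)
  · rw [hprod, roots_multiset_prod_X_sub_C]
    rfl
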